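/- arXiv:2509.17851 — 2 statements merged into one kernel-verified Lean document; each statement's English description precedes it below -/
import Mathlib

section
/- Let X be a topological space and f : X → X a continuous map, and let X_f be the mapping torus of f. Then the map ι : X → X_f sending x to the equivalence class [x, 0] is a closed embedding, i.e., a topological embedding whose image is a closed subset of X_f. -/
open Topology

/-- The generating relation for the mapping torus of `f : X → X`: the point `(x, 1)`
is identified with `(f x, 0)`. -/
def mappingTorusRel {X : Type*} (f : X → X) :
    X × unitInterval → X × unitInterval → Prop :=
  fun p q => p.2 = 1 ∧ q.2 = 0 ∧ q.1 = f p.1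

/-- The mapping torus of `f : X → X`: the quotient of `X × [0,1]` by the finest
equivalence relation identifying `(x, 1)` with `(f x, 0)`, with the quotient topology. -/
abbrev MappingTorus {X : Type*} (f : X → X) : Type _ :=
  Quot (mappingTorusRel f)

theorem mappingTorus_mk_zero_eq_mk_iff {X : Type*} {f : X → X} {x : X} {p : X × unitInterval} :
    Quot.mk (mappingTorusRel f) (x, 0) = Quot.mk (mappingTorusRel f) p ↔
      (p.1 = x ∧ p.2 = 0) ∨ (f p.1 = x ∧ p.2 = 1) := by
  constructor
  · intro h
    let P : MappingTorus f → Prop :=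
      Quot.lift (fun q => (q.1 = x ∧ q.2 = 0) ∨ (f q.1 = x ∧ q.2 = 1)) (by
        rintro ⟨a, s⟩ ⟨b, t⟩ ⟨hs, ht, hb⟩
        dsimp only at hs ht hb
        simp [hs, ht, hb])
    have hP : P (Quot.mk _ (x, 0)) := Or.inl ⟨rfl, rfl⟩
    rw [h] at hP
    exact hP
  · obtain ⟨a, s⟩ := p
    rintro (⟨rfl, rfl⟩ | ⟨rfl, rfl⟩)
    · rfl
    · exact (Quot.sound ⟨rfl, rfl, rfl⟩).symm

theorem mappingTorus_mk_preimage_image {X : Type*} (f : X → X) (C : Set X) :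
    Quot.mk (mappingTorusRel f) ⁻¹' ((fun x : X => Quot.mk (mappingTorusRel f) (x, 0)) '' C) =
      C ×ˢ {0} ∪ (f ⁻¹' C) ×ˢ {1} := by
  ext p
  simp only [Set.mem_preimage, Set.mem_image, mappingTorus_mk_zero_eq_mk_iff, Set.mem_union,
    Set.mem_prod, Set.mem_singleton_iff]
  grind

/-- The canonical map `X → X_f`, `x ↦ [x, 0]`, is a closed embedding. -/
theorem mappingTorus_inclusion_isClosedEmbedding {X : Type*} [TopologicalSpace X]
    (f : X → X) (hf : Continuous f) :
    IsClosedEmbedding (fun x : X => Quot.mk (mappingTorusRel f) (x, 0)) := by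
  refine .of_continuous_injective_isClosedMap ?_ ?_ ?_
  · exact continuous_quot_mk.comp (by fun_prop)
  · intro x y h
    simpa [eq_comm] using mappingTorus_mk_zero_eq_mk_iff.1 h
  · intro C hC
    rw [← isQuotientMap_quot_mk.isClosed_preimage, mappingTorus_mk_preimage_image]
    exact (hC.prod isClosed_singleton).union ((hC.preimage hf).prod isClosed_singleton)
end

section
/- Let Y be a topological space and g : Y → Y a continuous map. Then the formula (y, t) ↦ (g(y), t) descends to a well-defined continuous self-map g' : Y_g → Y_g of the mapping torus, given by g'([y, t]) = [g(y), t], and g' is homotopic to the identity map of Y_g. -/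
open unitInterval in
/-- The track of `(y, t)` under the suspension semiflow: `[y, t + s]` as long as `t + s ≤ 1`,
and `[g y, t + s - 1]` afterwards. -/
noncomputable def mappingTorusFlowAux {Y : Type*} (g : Y → Y) (s : I) (p : Y × I) :
    MappingTorus g :=
  if (p.2 + s : ℝ) ≤ 1 then
    Quot.mk _ (p.1, Set.projIcc 0 1 zero_le_one (p.2 + s : ℝ))
  else Quot.mk _ (g p.1, Set.projIcc 0 1 zero_le_one (p.2 + s - 1 : ℝ))

theorem mappingTorus_mk_one {Y : Type*} (g : Y → Y) (y : Y) :
    (Quot.mk _ (y, 1) : MappingTorus g) = Quot.mk _ (g y, 0) :=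
  Quot.sound ⟨rfl, rfl, rfl⟩

theorem continuous_mappingTorusFlowAux {Y : Type*} [TopologicalSpace Y] {g : Y → Y}
    (hg : Continuous g) :
    Continuous fun q : unitInterval × (Y × unitInterval) => mappingTorusFlowAux g q.1 q.2 := by
  unfold mappingTorusFlowAux
  refine Continuous.if_le (continuous_quot_mk.comp ?_) (continuous_quot_mk.comp ?_)
    (by fun_prop) continuous_const fun q hq => ?_
  · exact (by fun_prop : Continuous fun q : unitInterval × (Y × unitInterval) => q.2.1).prodMk
      (continuous_projIcc.comp (by fun_prop))
  · exact (by fun_prop : Continuous fun q : unitInterval × (Y × unitInterval) => g q.2.1).prodMk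
      (continuous_projIcc.comp (by fun_prop))
  · simp only [hq, sub_self, Set.projIcc_left, Set.projIcc_right]
    exact mappingTorus_mk_one g q.2.1

theorem mappingTorusFlowAux_zero {Y : Type*} (g : Y → Y) (p : Y × unitInterval) :
    mappingTorusFlowAux g 0 p = Quot.mk _ p := by
  simp [mappingTorusFlowAux, p.2.2.2]

theorem mappingTorusFlowAux_at_one {Y : Type*} (g : Y → Y) (s : unitInterval) (y : Y) :
    mappingTorusFlowAux g s (y, 1) = Quot.mk _ (g y, s) := by
  rcases eq_or_ne s 0 with rfl | hs
  · rw [mappingTorusFlowAux_zero, mappingTorus_mk_one]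
  · have : ¬ (s : ℝ) ≤ 0 := not_le.2 (unitInterval.pos_iff_ne_zero.2 hs)
    simp [mappingTorusFlowAux, this]

theorem mappingTorusFlowAux_at_zero {Y : Type*} (g : Y → Y) (s : unitInterval) (y : Y) :
    mappingTorusFlowAux g s (y, 0) = Quot.mk _ (y, s) := by
  simp [mappingTorusFlowAux, s.2.2]

theorem mappingTorusFlowAux_one {Y : Type*} (g : Y → Y) (y : Y) (t : unitInterval) :
    mappingTorusFlowAux g 1 (y, t) = Quot.mk _ (g y, t) := by
  rcases eq_or_ne t 0 with rfl | ht
  · rw [mappingTorusFlowAux_at_zero, mappingTorus_mk_one]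
  · have : ¬ (t : ℝ) ≤ 0 := not_le.2 (unitInterval.pos_iff_ne_zero.2 ht)
    simp [mappingTorusFlowAux, this]

/-- The suspension semiflow on the mapping torus, for times in `[0, 1]`. -/
noncomputable def mappingTorusFlow {Y : Type*} (g : Y → Y) (s : unitInterval) :
    MappingTorus g → MappingTorus g :=
  Quot.lift (mappingTorusFlowAux g s) <| by
    rintro ⟨y, t⟩ ⟨z, u⟩ ⟨ht, hu, hz⟩
    dsimp only at ht hu hz
    subst ht hu hz
    rw [mappingTorusFlowAux_at_one, mappingTorusFlowAux_at_zero]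

theorem continuous_mappingTorusFlow {Y : Type*} [TopologicalSpace Y] {g : Y → Y}
    (hg : Continuous g) :
    Continuous fun q : unitInterval × MappingTorus g => mappingTorusFlow g q.1 q.2 :=
  isQuotientMap_quot_mk.continuous_lift_prod_right (continuous_mappingTorusFlowAux hg)

/-- For a continuous map `g : Y → Y`, the formula `[y, t] ↦ [g y, t]` gives a well-defined
continuous self-map `g'` of the mapping torus `Y_g`, and `g'` is homotopic to the identity. -/
theorem mappingTorus_leafwise_map_homotopic_id {Y : Type*} [TopologicalSpace Y]
    (g : Y → Y) (hg : Continuous g) :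
    ∃ g' : C(MappingTorus g, MappingTorus g),
      (∀ (y : Y) (t : unitInterval),
        g' (Quot.mk (mappingTorusRel g) (y, t)) = Quot.mk (mappingTorusRel g) (g y, t)) ∧
      g'.Homotopic (ContinuousMap.id (MappingTorus g)) := by
  have hc := continuous_mappingTorusFlow hg
  let g' : C(MappingTorus g, MappingTorus g) :=
    ⟨mappingTorusFlow g 1, hc.comp (continuous_const.prodMk continuous_id)⟩
  refine ⟨g', mappingTorusFlowAux_one g, ContinuousMap.Homotopic.symm ⟨?_⟩⟩
  exact
    { toFun := fun q => mappingTorusFlow g q.1 q.2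
      continuous_toFun := hc
      map_zero_left := Quot.ind (mappingTorusFlowAux_zero g)
      map_one_left := fun _ => rfl }
end
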